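/- arXiv:1405.2436 — 2 statements merged into one kernel-verified Lean document; each statement's English description precedes it below -/
import Mathlib

section
/- Let A and B be commuting n × n complex matrices. Then there exists a unitary n × n matrix U such that both U* A U and U* B U are upper triangular matrices. -/
open Matrix

lemma common_eigenvector_aux {E : Type} [NormedAddCommGroup E] [InnerProductSpace ℂ E]
    [FiniteDimensional ℂ E] [Nontrivial E] (f g : Module.End ℂ E) (h : Commute f g) :
    ∃ u : E, ‖u‖ = 1 ∧ (∃ a : ℂ, f u = a • u) ∧ (∃ b : ℂ, g u = b • u) := by
  obtain ⟨a, ha⟩ := Module.End.exists_eigenvalue f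
  have hm : ∀ x ∈ f.eigenspace a, g x ∈ f.eigenspace a := by
    intro x hx
    rw [Module.End.mem_eigenspace_iff] at hx ⊢
    have h1 : f (g x) = g (f x) := congrArg (fun k : Module.End ℂ E => k x) h.eq
    rw [h1, hx, map_smul]
  have : Nontrivial (f.eigenspace a) := Submodule.nontrivial_iff_ne_bot.2 ha
  obtain ⟨b, hb⟩ := Module.End.exists_eigenvalue (g.restrict hm)
  obtain ⟨⟨v, hv⟩, hv1, hv0⟩ := hb.exists_hasEigenvector
  have hv0' : v ≠ 0 := fun h0 => hv0 (Subtype.ext h0)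
  have hgv : g v = b • v := congrArg Subtype.val (Module.End.mem_eigenspace_iff.1 hv1)
  have hfv : f v = a • v := Module.End.mem_eigenspace_iff.1 hv
  refine ⟨((‖v‖⁻¹ : ℝ) : ℂ) • v, ?_, ⟨a, ?_⟩, ⟨b, ?_⟩⟩
  · rw [norm_smul]
    have : ‖v‖ ≠ 0 := norm_ne_zero_iff.2 hv0'
    simp [this]
  · rw [map_smul, hfv, smul_comm]
  · rw [map_smul, hgv, smul_comm]

lemma triangular_basis_aux (n : ℕ) : ∀ (E : Type) [NormedAddCommGroup E] [InnerProductSpace ℂ E]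
    [FiniteDimensional ℂ E] (_ : Module.finrank ℂ E = n) (f g : Module.End ℂ E) (_ : Commute f g),
    ∃ b : Fin n → E, Orthonormal ℂ b ∧ (∀ i j, j < i → inner ℂ (b i) (f (b j)) = 0) ∧
      (∀ i j, j < i → inner ℂ (b i) (g (b j)) = 0) := by
  induction n with
  | zero =>
    intro E _ _ _ _ f g _
    exact ⟨Fin.elim0, ⟨fun i => i.elim0, fun i => i.elim0⟩, fun i => i.elim0, fun i => i.elim0⟩
  | succ n ih =>
    intro E _ _ _ hE f g h
    have : Nontrivial E := Module.nontrivial_of_finrank_pos (R := ℂ) (by omega)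
    have hadj : Commute (LinearMap.adjoint f) (LinearMap.adjoint g) := by
      have := congrArg LinearMap.adjoint h.eq
      simp only [Module.End.mul_eq_comp, LinearMap.adjoint_comp] at this
      exact this.symm
    obtain ⟨u, hu, ⟨a, ha⟩, ⟨c, hc⟩⟩ := common_eigenvector_aux _ _ hadj
    have hu0 : u ≠ 0 := by
      rintro rfl
      simp at hu
    have key : ∀ (k : Module.End ℂ E) (a : ℂ), LinearMap.adjoint k u = a • u →
        ∀ x ∈ (ℂ ∙ u)ᗮ, k x ∈ (ℂ ∙ u)ᗮ := by
      intro k a hk x hx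
      rw [Submodule.mem_orthogonal_singleton_iff_inner_right] at hx ⊢
      rw [← LinearMap.adjoint_inner_left, hk, inner_smul_left, hx, mul_zero]
    have hf := key f a ha
    have hg := key g c hc
    have : Fact (Module.finrank ℂ E = n + 1) := ⟨hE⟩
    obtain ⟨b, hb, hbf, hbg⟩ := ih ((ℂ ∙ u)ᗮ : Submodule ℂ E)
      (Submodule.finrank_orthogonal_span_singleton hu0) (f.restrict hf) (g.restrict hg) (by
        ext x
        exact congrArg (fun k : Module.End ℂ E => k x) h.eq)
    have hub : ∀ x ∈ (ℂ ∙ u)ᗮ, inner ℂ u x = 0 := fun x hx =>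
      (Submodule.mem_orthogonal_singleton_iff_inner_right).1 hx
    have tri : ∀ (k : Module.End ℂ E) (hk : ∀ x ∈ (ℂ ∙ u)ᗮ, k x ∈ (ℂ ∙ u)ᗮ),
        (∀ i j, j < i → inner ℂ (b i) ((k.restrict hk) (b j)) = 0) →
        ∀ i j : Fin (n + 1), j < i →
          inner ℂ ((Fin.snoc (fun i => (b i : E)) u : Fin (n + 1) → E) i)
            (k ((Fin.snoc (fun i => (b i : E)) u : Fin (n + 1) → E) j)) = 0 := by
      intro k hk hkb i j hij
      induction j using Fin.lastCases with
      | last => exact absurd hij (not_lt.2 (Fin.le_last i))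
      | cast j =>
        induction i using Fin.lastCases with
        | last =>
          simp only [Fin.snoc_last, Fin.snoc_castSucc]
          exact hub _ (hk _ (b j).2)
        | cast i =>
          simp only [Fin.snoc_castSucc]
          exact hkb i j (by simpa using hij)
    refine ⟨Fin.snoc (fun i => (b i : E)) u, ⟨?_, ?_⟩, tri f hf hbf, tri g hg hbg⟩
    · intro i
      induction i using Fin.lastCases with
      | last => simpa using hu
      | cast i => simpa using hb.1 i
    · intro i j hij
      induction i using Fin.lastCases with
      | last =>
        induction j using Fin.lastCases with
        | last => exact absurd rfl hij
        | cast j =>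
          simp only [Fin.snoc_last, Fin.snoc_castSucc]
          exact hub _ (b j).2
      | cast i =>
        induction j using Fin.lastCases with
        | last =>
          simp only [Fin.snoc_last, Fin.snoc_castSucc]
          exact inner_eq_zero_symm.1 (hub _ (b i).2)
        | cast j =>
          simp only [Fin.snoc_castSucc]
          exact hb.2 (fun h => hij (by rw [h]))

/-- Two commuting `n × n` complex matrices can be simultaneously unitarily
upper-triangularized. -/
theorem exists_unitary_simultaneous_upperTriangular {n : ℕ}
    (A B : Matrix (Fin n) (Fin n) ℂ) (h : A * B = B * A) :
    ∃ U : Matrix (Fin n) (Fin n) ℂ, Uᴴ * U = 1 ∧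
      (∀ i j : Fin n, j < i → (Uᴴ * A * U) i j = 0) ∧
      (∀ i j : Fin n, j < i → (Uᴴ * B * U) i j = 0) := by
  obtain ⟨b, hb, hA, hB⟩ := triangular_basis_aux n (EuclideanSpace ℂ (Fin n)) (by simp)
    (Matrix.toEuclideanLin A) (Matrix.toEuclideanLin B) (by
      ext x i
      have := congrArg (fun M : Matrix (Fin n) (Fin n) ℂ => (M *ᵥ x.ofLp) i) h
      simpa [Matrix.toLpLin_apply, ← Matrix.mulVec_mulVec] using this)
  have key : ∀ (M : Matrix (Fin n) (Fin n) ℂ) (i j : Fin n),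
      ((Matrix.of fun i j => b j i)ᴴ * M * (Matrix.of fun i j => b j i)) i j
        = inner ℂ (b i) (Matrix.toEuclideanLin M (b j)) := by
    intro M i j
    rw [Matrix.mul_assoc, Matrix.mul_apply, PiLp.inner_apply]
    refine Finset.sum_congr rfl fun k _ => ?_
    simp [Matrix.toLpLin_apply, Matrix.mul_apply, Matrix.mulVec, dotProduct, mul_comm]
  refine ⟨Matrix.of fun i j => b j i, ?_, ?_, ?_⟩
  · ext i j
    have := key 1 i j
    rw [Matrix.mul_one] at this
    rw [this, Matrix.one_apply, ← orthonormal_iff_ite.1 hb i j]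
    simp [Matrix.toLpLin_apply]
  · intro i j hij
    rw [key, hA i j hij]
  · intro i j hij
    rw [key, hB i j hij]
end

section
/- Let A and B be commuting upper-triangular n × n complex matrices. Then (λ, μ) ∈ ℂ² is a joint eigenvalue of (A, B) — that is, there exists a nonzero v ∈ ℂⁿ with A v = λ v and B v = μ v — if and only if there exists an index i with A i i = λ and B i i = μ. (In other words, the joint eigenvalues of a commuting pair of matrices are exactly the joint diagonal coefficients of a simultaneous triangularization.) -/
lemma aux_forward {n : ℕ}
    (A B : Matrix (Fin n) (Fin n) ℂ)
    (hA : ∀ i j : Fin n, j < i → A i j = 0) (hB : ∀ i j : Fin n, j < i → B i j = 0)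
    (lam mu : ℂ) (v : Fin n → ℂ) (hv : v ≠ 0)
    (h1 : A.mulVec v = lam • v) (h2 : B.mulVec v = mu • v) :
    ∃ i : Fin n, A i i = lam ∧ B i i = mu := by
  obtain ⟨k, hk⟩ := Function.ne_iff.mp hv
  have hne : (Finset.univ.filter (fun i => v i ≠ 0)).Nonempty := ⟨k, by simpa using hk⟩
  obtain ⟨i, hi, hmax⟩ := Finset.exists_max_image _ id hne
  simp only [Finset.mem_filter, Finset.mem_univ, true_and, id] at hi hmax
  have key : ∀ (M : Matrix (Fin n) (Fin n) ℂ) (c : ℂ), (∀ i j : Fin n, j < i → M i j = 0) →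
      M.mulVec v = c • v → M i i = c := by
    intro M c hM he
    have h3 := congrFun he i
    simp only [Matrix.mulVec, dotProduct, Pi.smul_apply, smul_eq_mul] at h3
    rw [Finset.sum_eq_single i] at h3
    · exact mul_right_cancel₀ hi h3
    · intro j _ hj
      rcases lt_or_gt_of_ne hj with hl | hg
      · rw [hM i j hl, zero_mul]
      · have : v j = 0 := by
          by_contra hvj
          exact absurd (hmax j hvj) (not_le.mpr hg)
        rw [this, mul_zero]
    · simp
  exact ⟨i, key A lam hA h1, key B mu hB h2⟩

/-- For commuting upper-triangular matrices `A, B`, the pair `(lam, mu)` is a joint eigenvalue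
of `(A, B)` if and only if `(lam, mu) = (A i i, B i i)` for some index `i`. -/
theorem jointEigenvalue_iff_diagonal {n : ℕ}
    (A B : Matrix (Fin n) (Fin n) ℂ) (h : A * B = B * A)
    (hA : ∀ i j : Fin n, j < i → A i j = 0) (hB : ∀ i j : Fin n, j < i → B i j = 0)
    (lam mu : ℂ) :
    (∃ v : Fin n → ℂ, v ≠ 0 ∧ A.mulVec v = lam • v ∧ B.mulVec v = mu • v) ↔
      ∃ i : Fin n, A i i = lam ∧ B i i = mu := by
  constructor
  · rintro ⟨v, hv, h1, h2⟩
    exact aux_forward A B hA hB lam mu v hv h1 h2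
  rintro ⟨i, hi1, hi2⟩
  obtain ⟨c, hc⟩ := Infinite.exists_notMem_finset
    (insert 0 (Finset.univ.image (fun k : Fin n => -(A k k - lam) / (B k k - mu))))
  simp only [Finset.mem_insert, Finset.mem_image, Finset.mem_univ, true_and, not_or,
    not_exists] at hc
  obtain ⟨hc0, hc⟩ := hc
  set D : Matrix (Fin n) (Fin n) ℂ := A + c • B - (lam + c * mu) • 1 with hD
  have hDdet : D.det = 0 := by
    rw [Matrix.det_of_isUpperTriangular]
    · apply Finset.prod_eq_zero (Finset.mem_univ i)
      simp [hD, hi1, hi2]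
    · intro a b hab
      have hab' : b < a := hab
      simp [hD, hA a b hab', hB a b hab', Matrix.one_apply_ne hab'.ne']
  obtain ⟨w, hw0, hw⟩ := Matrix.exists_mulVec_eq_zero_iff.mpr hDdet
  have hcomm : D * A = A * D := by
    simp [hD, sub_mul, mul_sub, add_mul, mul_add, h]
  let E := LinearMap.ker D.mulVecLin
  have hinv : ∀ x ∈ E, A.mulVecLin x ∈ E := by
    intro x hx
    have hx' : D.mulVec x = 0 := hx
    change D.mulVec (A.mulVec x) = 0
    rw [Matrix.mulVec_mulVec, hcomm, ← Matrix.mulVec_mulVec, hx', Matrix.mulVec_zero]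
  have : Nontrivial E := ⟨⟨⟨w, hw⟩, 0, fun hh => hw0 (congrArg Subtype.val hh)⟩⟩
  obtain ⟨l, hl⟩ := Module.End.exists_eigenvalue (A.mulVecLin.restrict hinv)
  obtain ⟨v, hv⟩ := hl.exists_hasEigenvector
  have hv1 : A.mulVec v.1 = l • v.1 := congrArg Subtype.val hv.apply_eq_smul
  have hv0 : v.1 ≠ 0 := fun hh => hv.2 (Subtype.ext hh)
  have hvD : D.mulVec v.1 = 0 := v.2
  have hv2 : B.mulVec v.1 = ((lam + c * mu - l) / c) • v.1 := by
    rw [hD, Matrix.sub_mulVec, Matrix.add_mulVec, Matrix.smul_mulVec, Matrix.smul_mulVec,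
      Matrix.one_mulVec, hv1] at hvD
    ext j
    have := congrFun hvD j
    simp only [Pi.sub_apply, Pi.add_apply, Pi.smul_apply, smul_eq_mul, Pi.zero_apply] at this ⊢
    field_simp
    linear_combination this
  obtain ⟨k, hk1, hk2⟩ := aux_forward A B hA hB _ _ v.1 hv0 hv1 hv2
  have hrel : c * (B k k - mu) = -(A k k - lam) := by
    rw [hk1, hk2]; field_simp; ring
  have hmu : B k k = mu := by
    by_contra hne
    have hne' := sub_ne_zero.mpr hne
    exact hc k ((eq_div_of_mul_eq hne' hrel).symm)
  have hlam : A k k = lam := by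
    rw [hmu] at hrel
    linear_combination hrel
  refine ⟨v.1, hv0, ?_, ?_⟩
  · rw [hv1, ← hk1, hlam]
  · rw [hv2, ← hk2, hmu]
end
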